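/- arXiv:1010.1651 — 2 statements merged into one kernel-verified Lean document; each statement's English description precedes it below -/
import Mathlib

section
/- For every (x,t) in the real plane, E(x,t) = F(x,t)ᵀ, where E(x,t) = e^{2Ax − 8A³t} + P e^{−2Ax + 8A³t} P; consequently E(x,t) is invertible on the entire (x,t)-plane. -/
open Matrix MeasureTheory Filter

noncomputable def mexp {p : ℕ} (M : Matrix (Fin p) (Fin p) ℝ) : Matrix (Fin p) (Fin p) ℝ :=
  ∑' k : ℕ, (k.factorial : ℝ)⁻¹ • M ^ k

def EigPos {p : ℕ} (A : Matrix (Fin p) (Fin p) ℝ) : Prop :=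
  ∀ μ ∈ spectrum ℂ (A.map Complex.ofReal), 0 < μ.re

def Observable {p : ℕ} (A : Matrix (Fin p) (Fin p) ℝ) (C : Matrix (Fin 1) (Fin p) ℝ) : Prop :=
  ∀ v : Fin p → ℝ, (∀ r : ℕ, (C * A ^ r) *ᵥ v = 0) → v = 0

def Controllable {p : ℕ} (A : Matrix (Fin p) (Fin p) ℝ) (B : Matrix (Fin p) (Fin 1) ℝ) : Prop :=
  ∀ v : Fin p → ℝ, (∀ r : ℕ, (Bᵀ * Aᵀ ^ r) *ᵥ v = 0) → v = 0

noncomputable def Qmat {p : ℕ} (A : Matrix (Fin p) (Fin p) ℝ) (C : Matrix (Fin 1) (Fin p) ℝ) :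
    Matrix (Fin p) (Fin p) ℝ :=
  Matrix.of fun i j =>
    ∫ s in Set.Ioi (0 : ℝ), (mexp (-(s • Aᵀ)) * (Cᵀ * C) * mexp (-(s • A))) i j

noncomputable def Nmat {p : ℕ} (A : Matrix (Fin p) (Fin p) ℝ) (B : Matrix (Fin p) (Fin 1) ℝ) :
    Matrix (Fin p) (Fin p) ℝ :=
  Matrix.of fun i j =>
    ∫ s in Set.Ioi (0 : ℝ), (mexp (-(s • A)) * (B * Bᵀ) * mexp (-(s • Aᵀ))) i j

noncomputable def Pmat {p : ℕ} (A : Matrix (Fin p) (Fin p) ℝ) (B : Matrix (Fin p) (Fin 1) ℝ)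
    (C : Matrix (Fin 1) (Fin p) ℝ) : Matrix (Fin p) (Fin p) ℝ :=
  Matrix.of fun i j =>
    ∫ s in Set.Ioi (0 : ℝ), (mexp (-(s • A)) * (B * C) * mexp (-(s • A))) i j

noncomputable def Fmat {p : ℕ} (A : Matrix (Fin p) (Fin p) ℝ) (B : Matrix (Fin p) (Fin 1) ℝ)
    (C : Matrix (Fin 1) (Fin p) ℝ) (x t : ℝ) : Matrix (Fin p) (Fin p) ℝ :=
  mexp ((2 * x) • Aᵀ - (8 * t) • Aᵀ ^ 3) +
    Qmat A C * mexp (-((2 * x) • A) + (8 * t) • A ^ 3) * Nmat A B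

noncomputable def Emat {p : ℕ} (A : Matrix (Fin p) (Fin p) ℝ) (B : Matrix (Fin p) (Fin 1) ℝ)
    (C : Matrix (Fin 1) (Fin p) ℝ) (x t : ℝ) : Matrix (Fin p) (Fin p) ℝ :=
  mexp ((2 * x) • A - (8 * t) • A ^ 3) +
    Pmat A B C * mexp (-((2 * x) • A) + (8 * t) • A ^ 3) * Pmat A B C

noncomputable def uFun {p : ℕ} (A : Matrix (Fin p) (Fin p) ℝ) (B : Matrix (Fin p) (Fin 1) ℝ)
    (C : Matrix (Fin 1) (Fin p) ℝ) (x t : ℝ) : ℝ :=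
  -2 * ((Bᵀ * (Fmat A B C x t)⁻¹ * Cᵀ : Matrix (Fin 1) (Fin 1) ℝ) 0 0)

noncomputable def vFun {p : ℕ} (A : Matrix (Fin p) (Fin p) ℝ) (B : Matrix (Fin p) (Fin 1) ℝ)
    (C : Matrix (Fin 1) (Fin p) ℝ) (x t : ℝ) : ℝ :=
  -2 * ((C * (Emat A B C x t)⁻¹ * B : Matrix (Fin 1) (Fin 1) ℝ) 0 0)

noncomputable def calQ {p : ℕ} (A : Matrix (Fin p) (Fin p) ℝ) (C : Matrix (Fin 1) (Fin p) ℝ)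
    (x t : ℝ) : Matrix (Fin p) (Fin p) ℝ :=
  mexp (-(x • Aᵀ)) * mexp ((8 * t) • Aᵀ ^ 3) * Qmat A C * mexp (-(x • A)) * mexp ((8 * t) • A ^ 3)

noncomputable def calN {p : ℕ} (A : Matrix (Fin p) (Fin p) ℝ) (B : Matrix (Fin p) (Fin 1) ℝ)
    (x : ℝ) : Matrix (Fin p) (Fin p) ℝ :=
  mexp (-(x • A)) * Nmat A B * mexp (-(x • Aᵀ))

noncomputable def Gam {p : ℕ} (A : Matrix (Fin p) (Fin p) ℝ) (B : Matrix (Fin p) (Fin 1) ℝ)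
    (C : Matrix (Fin 1) (Fin p) ℝ) (x t : ℝ) : Matrix (Fin p) (Fin p) ℝ :=
  1 + calQ A C x t * calN A B x

noncomputable def Om {p : ℕ} (A : Matrix (Fin p) (Fin p) ℝ) (B : Matrix (Fin p) (Fin 1) ℝ)
    (C : Matrix (Fin 1) (Fin p) ℝ) (w t : ℝ) : ℝ :=
  ((C * mexp (-(w • A)) * mexp ((8 * t) • A ^ 3) * B : Matrix (Fin 1) (Fin 1) ℝ) 0 0)

noncomputable def Kker {p : ℕ} (A : Matrix (Fin p) (Fin p) ℝ) (B : Matrix (Fin p) (Fin 1) ℝ)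
    (C : Matrix (Fin 1) (Fin p) ℝ) (x y t : ℝ) : ℝ :=
  ((Bᵀ * (Fmat A B C x t)⁻¹ * mexp (-((y - x) • Aᵀ)) * Cᵀ : Matrix (Fin 1) (Fin 1) ℝ) 0 0)


section Decay
open scoped Matrix.Norms.Operator Topology

theorem mexp_eq {p : ℕ} (M : Matrix (Fin p) (Fin p) ℝ) : mexp M = NormedSpace.exp M := by
  rw [NormedSpace.exp_eq_tsum ℝ]; rfl

theorem exp_mulVec_eig {p : ℕ} (M : Matrix (Fin p) (Fin p) ℂ) (v : Fin p → ℂ) (μ : ℂ)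
    (h : M *ᵥ v = μ • v) : NormedSpace.exp M *ᵥ v = Complex.exp μ • v := by
  have hp : ∀ k : ℕ, (M ^ k) *ᵥ v = μ ^ k • v := by
    intro k
    induction k with
    | zero => simp
    | succ k ih => rw [pow_succ, ← mulVec_mulVec, h, mulVec_smul, ih, smul_smul, pow_succ, mul_comm]
  have h1 := NormedSpace.exp_series_hasSum_exp' (𝕂 := ℂ) M
  let φ : Matrix (Fin p) (Fin p) ℂ →+ (Fin p → ℂ) :=
    { toFun := fun N => N *ᵥ v, map_zero' := zero_mulVec v, map_add' := fun a b => add_mulVec a b v }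
  have hc : Continuous φ := by
    change Continuous fun N : Matrix (Fin p) (Fin p) ℂ => N *ᵥ v
    fun_prop
  have h2 := h1.map φ hc
  have h3 := (NormedSpace.exp_series_hasSum_exp' (𝕂 := ℂ) μ).smul_const v
  rw [← Complex.exp_eq_exp_ℂ] at h3
  refine HasSum.unique h2 ?_
  convert h3 using 1
  ext1 k
  change ((k.factorial : ℂ)⁻¹ • M ^ k) *ᵥ v = _
  rw [smul_mulVec, hp, smul_smul, smul_eq_mul]

theorem spec_exp {p : ℕ} (M : Matrix (Fin p) (Fin p) ℂ) (l : ℂ)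
    (hl : l ∈ spectrum ℂ (NormedSpace.exp M)) : ∃ μ ∈ spectrum ℂ M, l = Complex.exp μ := by
  rw [← spectrum_toLin', ← Module.End.hasEigenvalue_iff_mem_spectrum] at hl
  set g := (NormedSpace.exp M).toLin' with hg
  have hcomm : Commute M (NormedSpace.exp M) := (Commute.refl M).exp_right
  have hinv : ∀ v ∈ Module.End.eigenspace g l, M.toLin' v ∈ Module.End.eigenspace g l := by
    intro v hv
    rw [Module.End.mem_eigenspace_iff] at hv ⊢
    simp only [hg, toLin'_apply] at hv ⊢
    rw [mulVec_mulVec, ← hcomm.eq, ← mulVec_mulVec, hv, mulVec_smul]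
  have : Nontrivial (Module.End.eigenspace g l) := Submodule.nontrivial_iff_ne_bot.2 hl
  obtain ⟨μ, hμ⟩ := Module.End.exists_eigenvalue (M.toLin'.restrict hinv)
  obtain ⟨w, hw⟩ := hμ.exists_hasEigenvector
  have hw1 : M *ᵥ (w : Fin p → ℂ) = μ • (w : Fin p → ℂ) := by
    have := congrArg Subtype.val hw.apply_eq_smul
    simpa using this
  have hw0 : (w : Fin p → ℂ) ≠ 0 := fun h => hw.2 (Subtype.ext h)
  refine ⟨μ, ?_, ?_⟩
  · rw [← spectrum_toLin', ← Module.End.hasEigenvalue_iff_mem_spectrum]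
    refine Module.End.hasEigenvalue_of_hasEigenvector (x := (w : Fin p → ℂ)) ⟨?_, hw0⟩
    rw [Module.End.mem_eigenspace_iff]; simpa using hw1
  · have h1 := exp_mulVec_eig M w μ hw1
    have h2 := Module.End.mem_eigenspace_iff.1 w.2
    simp only [hg, toLin'_apply] at h2
    exact smul_left_injective ℂ hw0 (h2.symm.trans h1)

theorem pow_tendsto_zero {p : ℕ} (M : Matrix (Fin p) (Fin p) ℂ)
    (h : ∀ l ∈ spectrum ℂ M, ‖l‖ < 1) : Tendsto (fun n : ℕ => M ^ n) atTop (𝓝 0) := by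
  rcases Nat.eq_zero_or_pos p with rfl | hp
  · exact tendsto_const_nhds.congr fun n => Subsingleton.elim 0 _
  have : Nonempty (Fin p) := ⟨⟨0, hp⟩⟩
  have hr : spectralRadius ℂ M < (1 : NNReal) :=
    spectrum.spectralRadius_lt_of_forall_lt M (fun k hk => h k hk)
  obtain ⟨r, hr1, hr2⟩ := ENNReal.lt_iff_exists_nnreal_btwn.1 hr
  have hg := spectrum.pow_nnnorm_pow_one_div_tendsto_nhds_spectralRadius M
  have hev := hg.eventually (gt_mem_nhds hr1)
  have hr3 : (r : ℝ) < 1 := by exact_mod_cast hr2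
  refine squeeze_zero_norm' ?_ (tendsto_pow_atTop_nhds_zero_of_lt_one r.2 hr3)
  filter_upwards [hev, eventually_gt_atTop 0] with n hn hn0
  have h5 : (‖M ^ n‖₊ : ENNReal) < (r : ENNReal) ^ n := by
    have := ENNReal.pow_lt_pow_left hn0.ne' hn
    rwa [← ENNReal.rpow_natCast, ← ENNReal.rpow_mul, one_div,
      inv_mul_cancel₀ (by exact_mod_cast hn0.ne'), ENNReal.rpow_one] at this
  have h6 : ‖M ^ n‖₊ < r ^ n := by exact_mod_cast h5
  exact_mod_cast h6.le

theorem exists_half {p : ℕ} (A : Matrix (Fin p) (Fin p) ℝ) (hA : EigPos A) :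
    ∃ m : ℕ, 0 < m ∧ ‖NormedSpace.exp (-((m : ℝ) • A))‖ ≤ 1 / 2 := by
  have hmap : (NormedSpace.exp (-A)).map Complex.ofReal
      = NormedSpace.exp (-(A.map Complex.ofReal)) := by
    have := NormedSpace.map_exp (Complex.ofRealHom.mapMatrix (m := Fin p)) (by
      change Continuous fun N : Matrix (Fin p) (Fin p) ℝ => N.map Complex.ofReal
      exact Continuous.matrix_map continuous_id Complex.continuous_ofReal) (-A)
    rw [map_neg] at this
    exact this
  have h1 := pow_tendsto_zero (NormedSpace.exp (-(A.map Complex.ofReal))) (by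
    intro l hl
    obtain ⟨μ, hμ, rfl⟩ := spec_exp _ l hl
    rw [← spectrum.neg_eq] at hμ
    have := hA (-μ) (by simpa using hμ)
    rw [Complex.norm_exp, Real.exp_lt_one_iff]
    simpa using this)
  have h2 : Tendsto (fun n : ℕ => (NormedSpace.exp (-A)) ^ n) atTop (𝓝 0) := by
    have hc : Continuous fun N : Matrix (Fin p) (Fin p) ℂ => N.map Complex.re :=
      Continuous.matrix_map continuous_id Complex.continuous_re
    have := (hc.tendsto 0).comp h1
    convert this using 1
    · ext n i j
      simp only [Function.comp, ← hmap]
      have : (NormedSpace.exp (-A)).map Complex.ofReal ^ n =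
         ((NormedSpace.exp (-A)) ^ n).map Complex.ofReal :=
        (map_pow (Complex.ofRealHom.mapMatrix (m := Fin p)) _ n).symm
      rw [this]; simp
    · congr 1
  have h3 := (tendsto_zero_iff_norm_tendsto_zero.1 h2).eventually (gt_mem_nhds (show (0:ℝ) < 1/2 by norm_num))
  obtain ⟨m, hm, hm0⟩ := (h3.and (eventually_gt_atTop 0)).exists
  refine ⟨m, hm0, ?_⟩
  have : -((m : ℝ) • A) = m • (-A) := by rw [smul_neg, Nat.cast_smul_eq_nsmul]
  rw [this, Matrix.exp_nsmul]
  exact hm.le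

theorem exp_decay {p : ℕ} (A : Matrix (Fin p) (Fin p) ℝ) (hA : EigPos A) :
    ∃ K a : ℝ, 0 < a ∧ 0 ≤ K ∧ ∀ s : ℝ, 0 ≤ s →
      ‖NormedSpace.exp (-(s • A))‖ ≤ K * Real.exp (-a * s) := by
  obtain ⟨m, hm, hhalf⟩ := exists_half A hA
  have hmr : (0:ℝ) < m := by exact_mod_cast hm
  have hcont : Continuous fun s : ℝ => NormedSpace.exp (-(s • A)) := by
    exact NormedSpace.exp_continuous.comp (by fun_prop)
  obtain ⟨K, hK⟩ := (isCompact_Icc (a := (0:ℝ)) (b := m)).exists_bound_of_continuousOn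
    hcont.continuousOn
  have hK0 : 0 ≤ K := (norm_nonneg _).trans (hK 0 ⟨le_rfl, hmr.le⟩)
  have hadd : ∀ s t : ℝ, NormedSpace.exp (-((s + t) • A)) =
      NormedSpace.exp (-(s • A)) * NormedSpace.exp (-(t • A)) := by
    intro s t
    rw [← Matrix.exp_add_of_commute, add_smul, neg_add]
    exact (((Commute.refl A).smul_left s).smul_right t).neg_left.neg_right
  have hstep : ∀ n : ℕ, ∀ r ∈ Set.Icc (0:ℝ) m,
      ‖NormedSpace.exp (-((n * (m:ℝ) + r) • A))‖ ≤ (1/2)^n * K := by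
    intro n r hr
    induction n with
    | zero => simpa using hK r hr
    | succ n ih =>
      have : ((n + 1 : ℕ) * (m:ℝ) + r) = m + (n * m + r) := by push_cast; ring
      rw [this, hadd]
      calc _ ≤ _ := norm_mul_le _ _
        _ ≤ (1/2) * ((1/2)^n * K) := by gcongr
        _ = _ := by ring
  refine ⟨2 * K, Real.log 2 / m, by positivity, by positivity, fun s hs => ?_⟩
  set n := ⌊s / m⌋₊
  have hn1 : (n : ℝ) ≤ s / m := Nat.floor_le (by positivity)
  have hn2 : s / m < n + 1 := Nat.lt_floor_add_one _
  rw [le_div_iff₀ hmr] at hn1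
  have hn3 := (div_lt_iff₀ hmr).1 hn2
  have := hstep n (s - n * m) ⟨by linarith, by linarith⟩
  rw [add_sub_cancel] at this
  refine this.trans ?_
  have h1 : ((1:ℝ)/2)^n = 2 * Real.exp (-(Real.log 2) * (n+1)) := by
    rw [mul_add, Real.exp_add, mul_comm _ (n:ℝ), Real.exp_nat_mul, mul_one, Real.exp_neg,
      Real.exp_log (by norm_num)]
    ring
  have h2 : Real.exp (-(Real.log 2) * (n+1)) ≤ Real.exp (-(Real.log 2 / m) * s) := by
    apply Real.exp_le_exp.2
    have : -(Real.log 2 / m) * s = -(Real.log 2) * (s / m) := by ring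
    rw [this]
    have := Real.log_pos (show (1:ℝ) < 2 by norm_num)
    nlinarith
  rw [h1]
  nlinarith

theorem integrable_entry {p : ℕ} (A : Matrix (Fin p) (Fin p) ℝ) (hA : EigPos A)
    (X Y D : Matrix (Fin p) (Fin p) ℝ) (hX : X = A ∨ X = Aᵀ) (hY : Y = A ∨ Y = Aᵀ) (i j : Fin p) :
    IntegrableOn (fun s : ℝ => (mexp (-(s • X)) * D * mexp (-(s • Y))) i j) (Set.Ioi 0) := by
  obtain ⟨K, a, ha, hK, hdec⟩ := exp_decay A hA
  have hent : ∀ X : Matrix (Fin p) (Fin p) ℝ, X = A ∨ X = Aᵀ → ∀ s : ℝ, 0 ≤ s → ∀ k l,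
      |(mexp (-(s • X))) k l| ≤ K * Real.exp (-a * s) := by
    have hb : ∀ (N : Matrix (Fin p) (Fin p) ℝ) k l, |N k l| ≤ ‖N‖ := by
      intro N k l
      rw [Matrix.linfty_opNorm_def]
      have h1 : ‖N k l‖₊ ≤ ∑ l, ‖N k l‖₊ :=
        Finset.single_le_sum (f := fun l => ‖N k l‖₊) (fun _ _ => zero_le) (Finset.mem_univ l)
      have h2 := h1.trans (Finset.le_sup (f := fun k => ∑ l, ‖N k l‖₊) (Finset.mem_univ k))
      exact_mod_cast h2
    rintro X (rfl | rfl) s hs k l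
    · rw [mexp_eq]; exact (hb _ _ _).trans (hdec s hs)
    · rw [mexp_eq, ← transpose_smul, ← transpose_neg, Matrix.exp_transpose]
      exact (hb _ l k).trans (hdec s hs)
  have hcont : ∀ X : Matrix (Fin p) (Fin p) ℝ, Continuous fun s : ℝ => mexp (-(s • X)) := by
    intro X
    simp only [mexp_eq]
    exact NormedSpace.exp_continuous.comp (by fun_prop)
  have hentc : ∀ (X : Matrix (Fin p) (Fin p) ℝ) k l, Continuous fun s : ℝ => mexp (-(s • X)) k l :=
    fun X k l => (hcont X).matrix_elem k l
  simp only [mul_apply, Finset.sum_mul]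
  refine integrable_finsetSum _ fun k _ => integrable_finsetSum _ fun l _ => ?_
  refine integrable_of_isBigO_exp_neg (b := a + a) (by positivity) ?_ ?_
  · exact (((hentc X i l).mul continuous_const).mul (hentc Y k j)).continuousOn
  · refine Asymptotics.IsBigO.of_bound (K * |D l k| * K) ?_
    filter_upwards [eventually_ge_atTop 0] with s hs
    rw [Real.norm_eq_abs, Real.norm_eq_abs, abs_mul, abs_mul, Real.abs_exp]
    have e : Real.exp (-(a + a) * s) = Real.exp (-a * s) * Real.exp (-a * s) := by
      rw [← Real.exp_add]; ring_nf
    rw [e]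
    calc _ ≤ (K * Real.exp (-a * s)) * |D l k| * (K * Real.exp (-a * s)) := by
          gcongr
          · exact hent X hX s hs _ _
          · exact hent Y hY s hs _ _
      _ = _ := by ring

end Decay

section Main
open scoped Matrix.Norms.Operator Topology

theorem mexp_intertwine {p : ℕ} (T X Y : Matrix (Fin p) (Fin p) ℝ) (h : T * X = Y * T) :
    T * mexp X = mexp Y * T := by
  rw [mexp_eq, mexp_eq]
  have hk : ∀ k : ℕ, T * X ^ k = Y ^ k * T := by
    intro k
    induction k with
    | zero => simp
    | succ k ih => rw [pow_succ, ← mul_assoc, ih, mul_assoc, h, ← mul_assoc, ← pow_succ]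
  have h1 := (NormedSpace.exp_series_hasSum_exp' (𝕂 := ℝ) X).mul_left T
  have h2 := (NormedSpace.exp_series_hasSum_exp' (𝕂 := ℝ) Y).mul_right T
  have e : (fun k : ℕ => T * ((k.factorial : ℝ)⁻¹ • X ^ k)) =
      fun k : ℕ => ((k.factorial : ℝ)⁻¹ • Y ^ k) * T := by
    ext1 k
    rw [mul_smul_comm, smul_mul_assoc, hk]
  rw [e] at h1
  exact h1.unique h2

theorem mexp_transpose {p : ℕ} (X : Matrix (Fin p) (Fin p) ℝ) : mexp Xᵀ = (mexp X)ᵀ := by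
  rw [mexp_eq, mexp_eq, Matrix.exp_transpose]

theorem mexp_unit {p : ℕ} (X : Matrix (Fin p) (Fin p) ℝ) : mexp X * mexp (-X) = 1 := by
  rw [mexp_eq, mexp_eq, ← Matrix.exp_add_of_commute _ _ (Commute.refl X).neg_right]
  simp

end Main

noncomputable def imat {p : ℕ} (f : ℝ → Matrix (Fin p) (Fin p) ℝ) : Matrix (Fin p) (Fin p) ℝ :=
  Matrix.of fun i j => ∫ s in Set.Ioi (0 : ℝ), f s i j

theorem imat_mul {p : ℕ} (f : ℝ → Matrix (Fin p) (Fin p) ℝ) (T : Matrix (Fin p) (Fin p) ℝ)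
    (hf : ∀ i j, IntegrableOn (fun s => f s i j) (Set.Ioi 0)) :
    imat f * T = imat fun s => f s * T := by
  ext i j
  simp only [imat, mul_apply, of_apply]
  rw [integral_finsetSum _ fun k _ => (hf i k).mul_const _]
  simp only [integral_mul_const]

theorem mul_imat {p : ℕ} (f : ℝ → Matrix (Fin p) (Fin p) ℝ) (T : Matrix (Fin p) (Fin p) ℝ)
    (hf : ∀ i j, IntegrableOn (fun s => f s i j) (Set.Ioi 0)) :
    T * imat f = imat fun s => T * f s := by
  ext i j
  simp only [imat, mul_apply, of_apply]
  rw [integral_finsetSum _ fun k _ => (hf k j).const_mul _]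
  simp only [integral_const_mul]

theorem imat_psd {p : ℕ} (f : ℝ → Matrix (Fin p) (Fin p) ℝ)
    (hf : ∀ i j, IntegrableOn (fun s => f s i j) (Set.Ioi 0)) (h : ∀ s, (f s).PosSemidef) :
    (imat f).PosSemidef := by
  refine PosSemidef.of_dotProduct_mulVec_nonneg ?_ ?_
  · ext i j
    simp only [imat, conjTranspose_apply, of_apply, star_trivial]
    congr 1; ext s
    simpa using congrFun (congrFun (h s).1 i) j
  · intro v
    have : star v ⬝ᵥ (imat f *ᵥ v) = ∫ s in Set.Ioi (0:ℝ), star v ⬝ᵥ (f s *ᵥ v) := by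
      simp only [imat, dotProduct, mulVec, of_apply]
      rw [integral_finsetSum]
      · refine Finset.sum_congr rfl fun i _ => ?_
        rw [integral_const_mul, integral_finsetSum _ fun k _ => (hf i k).mul_const _]
        simp only [integral_mul_const]
      · intro i _
        exact (integrable_finsetSum _ fun k _ => (hf i k).mul_const _).const_mul _
    rw [this]
    exact integral_nonneg fun s => (h s).dotProduct_mulVec_nonneg v

theorem exists_T {p : ℕ} (A : Matrix (Fin p) (Fin p) ℝ)
    (B : Matrix (Fin p) (Fin 1) ℝ) (C : Matrix (Fin 1) (Fin p) ℝ) (hobs : Observable A C) :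
    ∃ T : Matrix (Fin p) (Fin p) ℝ, T * Aᵀ = A * T ∧ T * Cᵀ = B ∧ C * T = Bᵀ := by
  let c : Fin p → ℝ := fun i => C 0 i
  let b : Fin p → ℝ := fun i => B i 0
  let ev (M : Matrix (Fin p) (Fin p) ℝ) (v : Fin p → ℝ) : Polynomial ℝ →ₗ[ℝ] (Fin p → ℝ) :=
    { toFun := fun q => Polynomial.aeval M q *ᵥ v
      map_add' := fun q r => by rw [map_add, add_mulVec]
      map_smul' := fun a q => by rw [map_smul, smul_mulVec]; rfl }
  have hev : ∀ M v q, ev M v q = Polynomial.aeval M q *ᵥ v := fun _ _ _ => rfl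
  have hsurj : LinearMap.range (ev Aᵀ c) = ⊤ := by
    by_contra hne
    obtain ⟨f, hf0, hf⟩ := Submodule.exists_le_ker_of_lt_top _ (lt_top_iff_ne_top.2 hne)
    apply hf0
    let w : Fin p → ℝ := fun i => f (Pi.single i 1)
    have hfw : ∀ v, f v = w ⬝ᵥ v := by
      intro v
      conv_lhs => rw [← Finset.univ_sum_single v]
      rw [map_sum]
      refine Finset.sum_congr rfl fun i _ => ?_
      rw [show (Pi.single i (v i) : Fin p → ℝ) = v i • Pi.single i 1 by
        rw [← Pi.single_smul]; simp, map_smul, smul_eq_mul, mul_comm]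
    have hw : w = 0 := by
      apply hobs
      intro r
      have h1 : f (ev Aᵀ c (Polynomial.X ^ r)) = 0 := hf ⟨_, rfl⟩
      rw [hfw, hev, map_pow, Polynomial.aeval_X, ← transpose_pow, mulVec_transpose,
        dotProduct_comm, ← dotProduct_mulVec] at h1
      rw [← mulVec_mulVec]
      ext i
      rw [Subsingleton.elim i 0]
      exact h1
    ext v
    simp [hfw, hw]
  have haT : ∀ q : Polynomial ℝ, Polynomial.aeval Aᵀ q = (Polynomial.aeval A q)ᵀ := by
    intro q
    induction q using Polynomial.induction_on' with
    | add q r h1 h2 => rw [map_add, map_add, h1, h2, transpose_add]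
    | monomial n a => simp [Polynomial.aeval_monomial, ← Algebra.smul_def]
  have hker : ∀ q, ev Aᵀ c q = 0 → Polynomial.aeval A q = 0 := by
    intro q hq
    rw [hev] at hq
    have h0 : Polynomial.aeval Aᵀ q = 0 := by
      apply Matrix.toLin'.injective
      refine LinearMap.ext fun v => ?_
      have : v ∈ LinearMap.range (ev Aᵀ c) := hsurj ▸ Submodule.mem_top
      obtain ⟨r, rfl⟩ := this
      simp only [toLin'_apply, hev, map_zero, LinearMap.zero_apply]
      rw [mulVec_mulVec, ← map_mul, mul_comm, map_mul, ← mulVec_mulVec, hq, mulVec_zero]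
    rw [haT, transpose_eq_zero] at h0
    exact h0
  obtain ⟨s, hs⟩ := (ev Aᵀ c).exists_rightInverse_of_surjective hsurj
  let T : Matrix (Fin p) (Fin p) ℝ := LinearMap.toMatrix' ((ev A b).comp s)
  have hT : ∀ q : Polynomial ℝ, T *ᵥ (Polynomial.aeval Aᵀ q *ᵥ c) = Polynomial.aeval A q *ᵥ b := by
    intro q
    rw [LinearMap.toMatrix'_mulVec, ← hev, ← hev, LinearMap.comp_apply]
    have h1 : ev Aᵀ c (s (ev Aᵀ c q) - q) = 0 := by
      rw [map_sub, sub_eq_zero]; exact LinearMap.congr_fun hs _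
    have h2 := hker _ h1
    rw [map_sub, sub_eq_zero] at h2
    exact congrArg (fun M => M *ᵥ b) h2
  have hsp : ∀ v, ∃ q : Polynomial ℝ, Polynomial.aeval Aᵀ q *ᵥ c = v := by
    intro v
    have : v ∈ LinearMap.range (ev Aᵀ c) := hsurj ▸ Submodule.mem_top
    exact this
  have hTc : T *ᵥ c = b := by simpa using hT 1
  have ext_mv : ∀ {m : ℕ} (M N : Matrix (Fin m) (Fin p) ℝ), (∀ v, M *ᵥ v = N *ᵥ v) → M = N :=
    fun M N h => Matrix.toLin'.injective (LinearMap.ext fun v => by simpa using h v)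
  refine ⟨T, ?_, ?_, ?_⟩
  · apply ext_mv
    intro v
    obtain ⟨q, rfl⟩ := hsp v
    have := hT (Polynomial.X * q)
    rw [map_mul, map_mul, Polynomial.aeval_X, Polynomial.aeval_X, ← mulVec_mulVec,
      ← mulVec_mulVec] at this
    rw [← mulVec_mulVec, this, ← mulVec_mulVec, hT]
  · ext i j
    rw [Subsingleton.elim j 0]
    exact congrFun hTc i
  · apply ext_mv
    intro v
    obtain ⟨q, rfl⟩ := hsp v
    rw [← mulVec_mulVec, hT, haT]
    ext i
    rw [Subsingleton.elim i 0]
    change c ⬝ᵥ (_ *ᵥ b) = b ⬝ᵥ (_ *ᵥ c)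
    rw [mulVec_transpose, dotProduct_comm b, ← dotProduct_mulVec]

theorem isUnit_one_add {p : ℕ} (S N : Matrix (Fin p) (Fin p) ℝ) (hS : S.PosSemidef)
    (hN : N.PosSemidef) : IsUnit (1 + S * N) := by
  rw [← mulVec_injective_iff_isUnit, ← coe_mulVecLin, ← LinearMap.ker_eq_bot, LinearMap.ker_eq_bot']
  intro v hv
  rw [mulVecLin_apply, add_mulVec, one_mulVec, ← mulVec_mulVec] at hv
  have h1 := hS.dotProduct_mulVec_nonneg (N *ᵥ v)
  have h2 := hN.dotProduct_mulVec_nonneg v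
  have h3 := congrArg (fun u => (N *ᵥ v) ⬝ᵥ u) hv
  simp only [dotProduct_add, dotProduct_zero, star_trivial] at h1 h2 h3
  rw [dotProduct_comm] at h2
  have h4 : star v ⬝ᵥ (N *ᵥ v) = 0 := by
    rw [star_trivial, dotProduct_comm]; linarith
  have h5 := (hN.dotProduct_mulVec_zero_iff v).1 h4
  simpa [h5] using hv

theorem core {p : ℕ} (A : Matrix (Fin p) (Fin p) ℝ)
    (B : Matrix (Fin p) (Fin 1) ℝ) (C : Matrix (Fin 1) (Fin p) ℝ)
    (hA : EigPos A) (hobs : Observable A C) (x t : ℝ) :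
    Emat A B C x t = (Fmat A B C x t)ᵀ ∧ IsUnit (Emat A B C x t) := by
  have hQ : Qmat A C = imat fun s => mexp (-(s • Aᵀ)) * (Cᵀ * C) * mexp (-(s • A)) := rfl
  have hN : Nmat A B = imat fun s => mexp (-(s • A)) * (B * Bᵀ) * mexp (-(s • Aᵀ)) := rfl
  have hP : Pmat A B C = imat fun s => mexp (-(s • A)) * (B * C) * mexp (-(s • A)) := rfl
  have iQ := integrable_entry A hA Aᵀ A (Cᵀ * C) (Or.inr rfl) (Or.inl rfl)
  have iN := integrable_entry A hA A Aᵀ (B * Bᵀ) (Or.inl rfl) (Or.inr rfl)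
  have iP := integrable_entry A hA A A (B * C) (Or.inl rfl) (Or.inl rfl)
  have mT : ∀ s : ℝ, mexp (-(s • Aᵀ)) = (mexp (-(s • A)))ᵀ := by
    intro s; rw [← mexp_transpose, transpose_neg, transpose_smul]
  have psdQ : (Qmat A C).PosSemidef := by
    rw [hQ]
    refine imat_psd _ iQ fun s => ?_
    have := posSemidef_conjTranspose_mul_self (C * mexp (-(s • A)))
    rw [conjTranspose_eq_transpose_of_trivial, transpose_mul] at this
    rw [mT]
    simpa only [mul_assoc, Matrix.mul_assoc] using this
  have psdN : (Nmat A B).PosSemidef := by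
    rw [hN]
    refine imat_psd _ iN fun s => ?_
    have := posSemidef_self_mul_conjTranspose (mexp (-(s • A)) * B)
    rw [conjTranspose_eq_transpose_of_trivial, transpose_mul] at this
    rw [mT]
    simpa only [mul_assoc, Matrix.mul_assoc] using this
  have symQ : (Qmat A C)ᵀ = Qmat A C := by
    rw [← conjTranspose_eq_transpose_of_trivial]; exact psdQ.1
  have symN : (Nmat A B)ᵀ = Nmat A B := by
    rw [← conjTranspose_eq_transpose_of_trivial]; exact psdN.1
  obtain ⟨T, hTA, hTC, hCT⟩ := exists_T A B C hobs
  have hTs : ∀ s : ℝ, T * mexp (-(s • Aᵀ)) = mexp (-(s • A)) * T := by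
    intro s
    apply mexp_intertwine
    simp [hTA]
  have hPQ : T * Qmat A C = Pmat A B C := by
    rw [hQ, hP, mul_imat _ _ iQ]
    congr 1; ext1 s
    rw [← Matrix.mul_assoc, ← Matrix.mul_assoc, hTs, Matrix.mul_assoc _ T, ← Matrix.mul_assoc T,
      hTC]
  have hPN : Pmat A B C * T = Nmat A B := by
    rw [hN, hP, imat_mul _ _ iP]
    congr 1; ext1 s
    rw [Matrix.mul_assoc, ← hTs, Matrix.mul_assoc, ← Matrix.mul_assoc _ T, Matrix.mul_assoc B, hCT,
      ← Matrix.mul_assoc]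
  set D := (2 * x) • A - (8 * t) • A ^ 3 with hD
  have hDn : -((2 * x) • A) + (8 * t) • A ^ 3 = -D := by rw [hD]; abel
  have hDT : (2 * x) • Aᵀ - (8 * t) • Aᵀ ^ 3 = Dᵀ := by
    rw [hD, transpose_sub, transpose_smul, transpose_smul, transpose_pow]
  have hTD : T * Dᵀ = D * T := by
    have h3 : T * Aᵀ ^ 3 = A ^ 3 * T := by
      have : SemiconjBy T Aᵀ A := hTA
      exact this.pow_right 3
    rw [← hDT, hD, mul_sub, sub_mul, mul_smul_comm, mul_smul_comm, smul_mul_assoc, smul_mul_assoc,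
      hTA, h3]
  have hTe : T * mexp (-D)ᵀ = mexp (-D) * T := by
    apply mexp_intertwine
    rw [transpose_neg, mul_neg, neg_mul, hTD]
  have hEF : Emat A B C x t = (Fmat A B C x t)ᵀ := by
    rw [Emat, Fmat, hDn, hDT, ← hD, transpose_add, transpose_mul, transpose_mul, symQ, symN,
      mexp_transpose, transpose_transpose, ← mexp_transpose (-D)]
    congr 1
    conv_lhs => rw [← hPQ]
    rw [hPQ, ← hPN]
    nth_rewrite 2 [← hPQ]
    rw [mul_assoc, ← mul_assoc (mexp (-D)), ← hTe]
    simp only [mul_assoc]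
  refine ⟨hEF, ?_⟩
  rw [hEF, isUnit_transpose, Fmat, hDn, hDT]
  have psdS : (mexp (-D)ᵀ * Qmat A C * mexp (-D)).PosSemidef := by
    have := psdQ.conjTranspose_mul_mul_same (mexp (-D))
    rwa [conjTranspose_eq_transpose_of_trivial, ← mexp_transpose] at this
  have hu := isUnit_one_add _ _ psdS psdN
  have h1 : mexp Dᵀ * mexp (-D)ᵀ = 1 := by
    rw [transpose_neg]; exact mexp_unit _
  have h2 : mexp Dᵀ + Qmat A C * mexp (-D) * Nmat A B =
      mexp Dᵀ * (1 + mexp (-D)ᵀ * Qmat A C * mexp (-D) * Nmat A B) := by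
    rw [mul_add, mul_one]
    simp only [← mul_assoc]
    rw [h1, one_mul]
  rw [h2]
  refine IsUnit.mul ?_ hu
  rw [isUnit_iff_isUnit_det]
  exact isUnit_det_of_right_inverse h1

theorem statement10 {p : ℕ} (hp : 0 < p) (A : Matrix (Fin p) (Fin p) ℝ)
    (B : Matrix (Fin p) (Fin 1) ℝ) (C : Matrix (Fin 1) (Fin p) ℝ)
    (hA : EigPos A) (hobs : Observable A C) (hctrl : Controllable A B) :
    ∀ x t : ℝ, Emat A B C x t = (Fmat A B C x t)ᵀ ∧ IsUnit (Emat A B C x t) := by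
  exact fun x t => core A B C hA hobs x t
end

section
/- If all complex eigenvalues of the real p×p matrix A have positive real part, then for any real 1×p matrix C the Lyapunov equation AᵀQ + QA = CᵀC has exactly one real p×p solution Q, namely Q = ∫₀^∞ e^{−Aᵀs} Cᵀ C e^{−As} ds; similarly, for any real p×1 matrix B the Lyapunov equation AN + NAᵀ = BBᵀ has exactly one real p×p solution N, namely N = ∫₀^∞ e^{−As} B Bᵀ e^{−Aᵀs} ds, and both solutions are symmetric. -/
open Matrix MeasureTheory Filter

section Aux14

open NormedSpace Asymptotics Topology

attribute [local instance] Matrix.linftyOpNormedRing Matrix.linftyOpNormedAlgebra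

def Dec14 {E : Type*} [NormedField E] (f : ℝ → E) : Prop :=
  ∃ d : ℝ, 0 < d ∧ f =O[atTop] fun s : ℝ => Real.exp (-d * s)

theorem exp_mono14 {a b : ℝ} (h : a ≤ b) :
    (fun s : ℝ => Real.exp (-b * s)) =O[atTop] fun s : ℝ => Real.exp (-a * s) := by
  apply IsBigO.of_bound 1
  filter_upwards [eventually_ge_atTop 0] with s hs
  rw [Real.norm_eq_abs, Real.norm_eq_abs, Real.abs_exp, Real.abs_exp, one_mul]
  apply Real.exp_le_exp.2
  nlinarith

theorem Dec14.zero {E : Type*} [NormedField E] : Dec14 (fun _ => (0 : E)) :=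
  ⟨1, one_pos, isBigO_zero _ _⟩

theorem Dec14.add {E : Type*} [NormedField E] {f g : ℝ → E} (hf : Dec14 f) (hg : Dec14 g) :
    Dec14 (fun s => f s + g s) := by
  obtain ⟨a, ha, hf⟩ := hf
  obtain ⟨b, hb, hg⟩ := hg
  exact ⟨min a b, lt_min ha hb, (hf.trans (exp_mono14 (min_le_left _ _))).add
    (hg.trans (exp_mono14 (min_le_right _ _)))⟩

theorem Dec14.mul {E : Type*} [NormedField E] {f g : ℝ → E} (hf : Dec14 f) (hg : Dec14 g) :
    Dec14 (fun s => f s * g s) := by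
  obtain ⟨a, ha, hf⟩ := hf
  obtain ⟨b, hb, hg⟩ := hg
  refine ⟨a + b, add_pos ha hb, (hf.mul hg).congr_right fun s => ?_⟩
  rw [← Real.exp_add]; congr 1; ring

theorem Dec14.mul_const {E : Type*} [NormedField E] {f : ℝ → E} (hf : Dec14 f) (c : E) :
    Dec14 (fun s => f s * c) := by
  obtain ⟨a, ha, hf⟩ := hf
  refine ⟨a, ha, ?_⟩
  simpa [mul_comm] using hf.const_mul_left c

theorem Dec14.sum {E ι : Type*} [NormedField E] (t : Finset ι) {f : ι → ℝ → E}
    (hf : ∀ i, Dec14 (f i)) : Dec14 (fun s => ∑ i ∈ t, f i s) := by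
  classical
  induction t using Finset.induction_on with
  | empty => simpa using Dec14.zero
  | insert a t ha ih => simpa [Finset.sum_insert ha] using (hf a).add ih

theorem Dec14.base (l : ℂ) (hl : 0 < l.re) (k : ℕ) :
    Dec14 (fun s : ℝ => Complex.exp (-(s : ℂ) * l) * (-(s : ℂ)) ^ k) := by
  refine ⟨l.re / 2, by positivity, ?_⟩
  have h1 : (fun s : ℝ => Complex.exp (-(s : ℂ) * l)) =O[atTop]
      fun s : ℝ => Real.exp (-l.re * s) := by
    apply IsBigO.of_bound 1
    filter_upwards with s
    rw [Complex.norm_exp, Real.norm_eq_abs, Real.abs_exp]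
    simp [mul_comm]
  have h2 : (fun s : ℝ => (-(s : ℂ)) ^ k) =O[atTop] fun s : ℝ => Real.exp (l.re / 2 * s) := by
    refine IsBigO.trans ?_ (isLittleO_pow_exp_pos_mul_atTop k (half_pos hl)).isBigO
    apply IsBigO.of_bound 1
    filter_upwards with s
    simp
  refine (h1.mul h2).congr_right fun s => ?_
  rw [← Real.exp_add]; congr 1; ring

theorem exp_mulVec_nil14 {p : ℕ} (N : Matrix (Fin p) (Fin p) ℂ) (n : ℕ) (v : Fin p → ℂ)
    (h : N ^ n *ᵥ v = 0) (z : ℂ) :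
    exp (z • N) *ᵥ v = ∑ k ∈ Finset.range n, ((k.factorial : ℂ)⁻¹ * z ^ k) • (N ^ k *ᵥ v) := by
  have hs := exp_series_hasSum_exp' (𝕂 := ℂ) (z • N)
  have hc : Continuous fun M : Matrix (Fin p) (Fin p) ℂ => M *ᵥ v :=
    continuous_id.matrix_mulVec continuous_const
  have h1 := hs.map (Matrix.mulVecBilin ℂ ℂ |>.flip v) hc
  have h2 : HasSum (fun k : ℕ => ((k.factorial : ℂ)⁻¹ * z ^ k) • (N ^ k *ᵥ v))
      (exp (z • N) *ᵥ v) := by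
    convert h1 using 1
    · ext k : 1
      simp [smul_pow, smul_smul]
    · rfl
  refine h2.unique (hasSum_sum_of_ne_finset_zero fun k hk => ?_)
  have hk' : n ≤ k := by simpa using hk
  obtain ⟨m, rfl⟩ := Nat.exists_eq_add_of_le hk'
  rw [add_comm n m, pow_add N, ← Matrix.mulVec_mulVec, h]
  simp

theorem exp_shift14 {p : ℕ} (M : Matrix (Fin p) (Fin p) ℂ) (l z : ℂ) :
    exp (z • M) = Complex.exp (z * l) • exp (z • (M - l • 1)) := by
  have h : z • M = algebraMap ℂ (Matrix (Fin p) (Fin p) ℂ) (z * l) + z • (M - l • 1) := by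
    rw [Algebra.algebraMap_eq_smul_one, smul_sub, smul_smul]; abel
  have h2 : exp (algebraMap ℂ (Matrix (Fin p) (Fin p) ℂ) (z * l)) =
      algebraMap ℂ (Matrix (Fin p) (Fin p) ℂ) (exp (z * l)) :=
    (algebraMap_exp_comm (𝕂 := ℂ) (𝔸 := Matrix (Fin p) (Fin p) ℂ) (z * l)).symm
  rw [h, Matrix.exp_add_of_commute _ _ (Algebra.commute_algebraMap_left _ _), h2,
    ← Algebra.smul_def, Complex.exp_eq_exp_ℂ]

theorem dec_gen14 {p : ℕ} (M : Matrix (Fin p) (Fin p) ℂ) (l : ℂ) (hl : 0 < l.re) (n : ℕ)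
    (v : Fin p → ℂ) (h : (M - l • 1) ^ n *ᵥ v = 0) (i : Fin p) :
    Dec14 (fun s : ℝ => (exp ((-(s : ℂ)) • M) *ᵥ v) i) := by
  have : (fun s : ℝ => (exp ((-(s : ℂ)) • M) *ᵥ v) i) = fun s : ℝ =>
      ∑ k ∈ Finset.range n, (Complex.exp (-(s : ℂ) * l) * (-(s : ℂ)) ^ k) *
        ((k.factorial : ℂ)⁻¹ * ((M - l • 1) ^ k *ᵥ v) i) := by
    ext s
    rw [exp_shift14 M l, Matrix.smul_mulVec, exp_mulVec_nil14 _ n v h]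
    simp only [Pi.smul_apply, Finset.sum_apply, smul_eq_mul, Finset.mul_sum]
    refine Finset.sum_congr rfl fun k _ => ?_
    ring
  rw [this]
  exact Dec14.sum _ fun k => (Dec14.base l hl k).mul_const _

theorem dec_all14 {p : ℕ} (M : Matrix (Fin p) (Fin p) ℂ) (hM : ∀ μ ∈ spectrum ℂ M, 0 < μ.re)
    (v : Fin p → ℂ) : ∀ i : Fin p, Dec14 (fun s : ℝ => (exp ((-(s : ℂ)) • M) *ᵥ v) i) := by
  have hv : v ∈ ⨆ μ : ℂ, Module.End.maxGenEigenspace (Matrix.toLin' M) μ := by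
    rw [Module.End.iSup_maxGenEigenspace_eq_top]; trivial
  induction hv using Submodule.iSup_induction' with
  | zero => intro i; simpa using Dec14.zero
  | add x y _ _ hx hy =>
    intro i
    simpa [Matrix.mulVec_add] using (hx i).add (hy i)
  | mem l x hx =>
    intro i
    obtain ⟨n, hn⟩ := Module.End.mem_genEigenspace_top.1 hx
    have hn' : (M - l • 1) ^ n *ᵥ x = 0 := by
      have e : Matrix.toLin' M - l • (1 : Module.End ℂ (Fin p → ℂ)) =
          Matrix.toLin' (M - l • 1) := by
        rw [map_sub, map_smul, Matrix.toLin'_one]; rfl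
      rw [LinearMap.mem_ker, e, ← Matrix.toLin'_pow, Matrix.toLin'_apply] at hn
      exact hn
    by_cases hl : l ∈ spectrum ℂ M
    · exact dec_gen14 M l (hM l hl) n x hn' i
    · rw [spectrum.notMem_iff, Algebra.algebraMap_eq_smul_one, ← IsUnit.neg_iff, neg_sub] at hl
      have hx0 : x = 0 := by
        obtain ⟨u, hu⟩ := hl.pow n
        rw [← hu] at hn'
        have := congrArg (fun w => (↑u⁻¹ : Matrix (Fin p) (Fin p) ℂ) *ᵥ w) hn'
        simpa [Matrix.mulVec_mulVec] using this
      subst hx0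
      simpa using Dec14.zero

theorem mexp_eq14 {p : ℕ} (M : Matrix (Fin p) (Fin p) ℝ) : mexp M = exp M := by
  rw [exp_eq_tsum ℝ]; rfl

theorem exp_map14 {p : ℕ} (M : Matrix (Fin p) (Fin p) ℝ) :
    exp (M.map Complex.ofReal) = (exp M).map Complex.ofReal := by
  have := map_exp (Complex.ofRealHom.mapMatrix (m := Fin p))
    (continuous_id.matrix_map Complex.continuous_ofReal) M
  exact this.symm

theorem dec_real14 {p : ℕ} (A : Matrix (Fin p) (Fin p) ℝ) (hA : EigPos A) (i j : Fin p) :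
    Dec14 (fun s : ℝ => mexp (-(s • A)) i j) := by
  obtain ⟨d, hd, h⟩ := dec_all14 _ hA (Pi.single j 1) i
  refine ⟨d, hd, IsBigO.trans ?_ h⟩
  apply IsBigO.of_bound 1
  filter_upwards with s
  have e : (-(s : ℂ)) • A.map Complex.ofReal = (-(s • A)).map Complex.ofReal := by
    ext a b; simp
  rw [e, exp_map14, mexp_eq14]
  simp

theorem mexp_transpose14 {p : ℕ} (A : Matrix (Fin p) (Fin p) ℝ) (s : ℝ) :
    mexp (-(s • Aᵀ)) = (mexp (-(s • A)))ᵀ := by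
  rw [mexp_eq14, mexp_eq14, ← Matrix.exp_transpose]; simp

theorem key14 {p : ℕ} (A₁ A₂ : Matrix (Fin p) (Fin p) ℝ)
    (h₁ : ∀ i j, Dec14 (fun s : ℝ => mexp (-(s • A₁)) i j))
    (h₂ : ∀ i j, Dec14 (fun s : ℝ => mexp (-(s • A₂)) i j))
    (Q : Matrix (Fin p) (Fin p) ℝ) (i j : Fin p) :
    ∫ s in Set.Ioi (0 : ℝ), (mexp (-(s • A₁)) * (A₁ * Q + Q * A₂) * mexp (-(s • A₂))) i j
      = Q i j := by
  have hdec : ∀ Y : Matrix (Fin p) (Fin p) ℝ,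
      Dec14 fun s : ℝ => (mexp (-(s • A₁)) * Y * mexp (-(s • A₂))) i j := by
    intro Y
    simp only [Matrix.mul_apply]
    exact Dec14.sum _ fun k => (Dec14.sum _ fun l => (h₁ _ _).mul_const _).mul (h₂ _ _)
  have hder : ∀ (Y : Matrix (Fin p) (Fin p) ℝ) (s : ℝ),
      HasDerivAt (fun s : ℝ => (mexp (-(s • A₁)) * Y * mexp (-(s • A₂))) i j)
        (-(mexp (-(s • A₁)) * (A₁ * Y + Y * A₂) * mexp (-(s • A₂))) i j) s := by
    intro Y s
    simp only [mexp_eq14, ← smul_neg]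
    have d := ((hasDerivAt_exp_smul_const (-A₁) s).mul_const Y).mul
      (hasDerivAt_exp_smul_const' (-A₂) s)
    let L : Matrix (Fin p) (Fin p) ℝ →L[ℝ] ℝ :=
      LinearMap.toContinuousLinearMap (Matrix.entryLinearMap ℝ ℝ i j)
    have d2 := L.hasFDerivAt.comp_hasDerivAt s d
    refine d2.congr_deriv ?_
    change (exp (s • -A₁) * -A₁ * Y * exp (s • -A₂) +
      exp (s • -A₁) * Y * (-A₂ * exp (s • -A₂))) i j = _
    rw [← Matrix.neg_apply]
    refine congrFun (congrFun ?_ i) j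
    generalize exp (s • -A₁) = E₁
    generalize exp (s • -A₂) = E₂
    simp only [mul_add, add_mul, mul_neg, neg_mul, mul_assoc, neg_add]
    rfl
  have hint : IntegrableOn (fun s : ℝ =>
      (mexp (-(s • A₁)) * (A₁ * Q + Q * A₂) * mexp (-(s • A₂))) i j) (Set.Ioi 0) := by
    obtain ⟨d, hd, hO⟩ := hdec (A₁ * Q + Q * A₂)
    exact integrable_of_isBigO_exp_neg hd
      (fun s _ => (hder _ s).continuousAt.continuousWithinAt) hO
  have hlim : Tendsto (fun s : ℝ => (mexp (-(s • A₁)) * Q * mexp (-(s • A₂))) i j)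
      atTop (𝓝 0) := by
    obtain ⟨d, hd, hO⟩ := hdec Q
    refine hO.trans_tendsto ?_
    refine Real.tendsto_exp_atBot.comp ?_
    exact tendsto_id.const_mul_atTop_of_neg (by linarith)
  have := integral_Ioi_of_hasDerivAt_of_tendsto' (a := 0) (fun s _ => hder Q s) hint.neg hlim
  rw [integral_neg] at this
  simp only [zero_smul, neg_zero, mexp_eq14, exp_zero, one_mul, mul_one, zero_sub, neg_inj] at this
  simpa only [mexp_eq14] using this

theorem main14 {p : ℕ} (A₁ A₂ : Matrix (Fin p) (Fin p) ℝ)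
    (h₁ : ∀ i j, Dec14 (fun s : ℝ => mexp (-(s • A₁)) i j))
    (h₂ : ∀ i j, Dec14 (fun s : ℝ => mexp (-(s • A₂)) i j))
    (X I : Matrix (Fin p) (Fin p) ℝ)
    (hI : I = Matrix.of fun i j =>
      ∫ s in Set.Ioi (0 : ℝ), (mexp (-(s • A₁)) * X * mexp (-(s • A₂))) i j) :
    A₁ * I + I * A₂ = X ∧ ∀ Q, A₁ * Q + Q * A₂ = X → Q = I := by
  have huniq : ∀ Q, A₁ * Q + Q * A₂ = X → Q = I := by
    rintro Q rfl
    rw [hI]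
    ext i j
    exact (key14 A₁ A₂ h₁ h₂ Q i j).symm
  refine ⟨?_, huniq⟩
  let T : Matrix (Fin p) (Fin p) ℝ →ₗ[ℝ] Matrix (Fin p) (Fin p) ℝ :=
    LinearMap.mulLeft ℝ A₁ + LinearMap.mulRight ℝ A₂
  have hT : ∀ Q, T Q = A₁ * Q + Q * A₂ := fun Q => rfl
  have hinj : Function.Injective T := by
    intro Q R hQR
    rw [hT, hT] at hQR
    ext i j
    rw [← key14 A₁ A₂ h₁ h₂ Q i j, ← key14 A₁ A₂ h₁ h₂ R i j, hQR]
  obtain ⟨Q, hQ⟩ := (LinearMap.injective_iff_surjective.1 hinj) X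
  rw [hT] at hQ
  rw [← huniq Q hQ, hQ]

end Aux14

theorem statement14 {p : ℕ} (hp : 0 < p) (A : Matrix (Fin p) (Fin p) ℝ) (hA : EigPos A) :
    (∀ C : Matrix (Fin 1) (Fin p) ℝ,
      (Aᵀ * Qmat A C + Qmat A C * A = Cᵀ * C) ∧
      (∀ Q' : Matrix (Fin p) (Fin p) ℝ, Aᵀ * Q' + Q' * A = Cᵀ * C → Q' = Qmat A C) ∧
      (Qmat A C)ᵀ = Qmat A C) ∧
    (∀ B : Matrix (Fin p) (Fin 1) ℝ,
      (A * Nmat A B + Nmat A B * Aᵀ = B * Bᵀ) ∧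
      (∀ N' : Matrix (Fin p) (Fin p) ℝ, A * N' + N' * Aᵀ = B * Bᵀ → N' = Nmat A B) ∧
      (Nmat A B)ᵀ = Nmat A B) := by
  have h₁ := dec_real14 A hA
  have h₂ : ∀ i j, Dec14 (fun s : ℝ => mexp (-(s • Aᵀ)) i j) := by
    intro i j
    simp only [mexp_transpose14, Matrix.transpose_apply]
    exact h₁ j i
  refine ⟨fun C => ?_, fun B => ?_⟩
  · obtain ⟨hs, hu⟩ := main14 Aᵀ A h₂ h₁ (Cᵀ * C) (Qmat A C) rfl
    refine ⟨hs, hu, hu _ ?_⟩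
    have := congrArg Matrix.transpose hs
    simp only [Matrix.transpose_add, Matrix.transpose_mul, Matrix.transpose_transpose] at this
    rw [add_comm, this]
  · obtain ⟨hs, hu⟩ := main14 A Aᵀ h₁ h₂ (B * Bᵀ) (Nmat A B) rfl
    refine ⟨hs, hu, hu _ ?_⟩
    have := congrArg Matrix.transpose hs
    simp only [Matrix.transpose_add, Matrix.transpose_mul, Matrix.transpose_transpose] at this
    rw [add_comm, this]
end
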